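/- Assume (h1) and (f1)–(f4). Then for every u ∈ H_{s,p} with u⁺ ≢ 0 there exists a unique t_u > 0 such that t_u·u belongs to the Nehari set M, and moreover J̃(t_u·u) = sup_{t>0} J̃(t·u). In particular, if u ∈ M then t_u = 1 and J̃(u) = sup_{t>0} J̃(t·u). -/

import Mathlib

open MeasureTheory Filter Topology
open scoped ENNReal

noncomputable section

namespace DiscreteChoquard

variable {d : ℕ}

/-- The lattice `ℤ^d`. -/
abbrev Z (d : ℕ) := Fin d → ℤ

/-- Graph distance on `ℤ^d`, as a real number. -/
def latDist (x y : Z d) : ℝ := ∑ i, |((x i - y i : ℤ) : ℝ)|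

/-- The kernel hypotheses on `W_s`: symmetry, positivity, and the two-sided bound
`c|x−y|^{−d−2s} ≤ W_s(x,y) ≤ C|x−y|^{−d−2s}` for `x ≠ y`. -/
def KernelOK (d : ℕ) (s : ℝ) (W : Z d → Z d → ℝ) : Prop :=
  (∀ x y, W x y = W y x) ∧ (∀ x y, 0 < W x y) ∧
  ∃ c C : ℝ, 0 < c ∧ c ≤ C ∧ ∀ x y : Z d, x ≠ y →
    c * latDist x y ^ (-(d : ℝ) - 2 * s) ≤ W x y ∧
      W x y ≤ C * latDist x y ^ (-(d : ℝ) - 2 * s)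

/-- The fractional gradient form `∇^s u ∇^s v (x)`.  (The `y = x` summand vanishes, so we
sum over all `y`.) -/
def gradForm (W : Z d → Z d → ℝ) (u v : Z d → ℝ) (x : Z d) : ℝ :=
  (1 / 2) * ∑' y : Z d, W x y * (u x - u y) * (v x - v y)

/-- `|∇^s u|(x)`. -/
def gradNorm (W : Z d → Z d → ℝ) (u : Z d → ℝ) (x : Z d) : ℝ :=
  Real.sqrt ((1 / 2) * ∑' y : Z d, W x y * (u x - u y) ^ 2)

/-- The fractional `p`-Laplacian `(−Δ)_p^s u (x)`. -/
def pLap (W : Z d → Z d → ℝ) (p : ℝ) (u : Z d → ℝ) (x : Z d) : ℝ :=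
  (1 / 2) * ∑' y : Z d,
    W x y * (gradNorm W u x ^ (p - 2) + gradNorm W u y ^ (p - 2)) * (u x - u y)

/-- `‖u‖_{H_{s,p}}^p = ∑_x (|∇^s u|^p(x) + h(x)|u(x)|^p)`. -/
def HnormP (W : Z d → Z d → ℝ) (h : Z d → ℝ) (p : ℝ) (u : Z d → ℝ) : ℝ :=
  ∑' x : Z d, (gradNorm W u x ^ p + h x * |u x| ^ p)

/-- `‖u‖_{H_{s,p}}`. -/
def normH (W : Z d → Z d → ℝ) (h : Z d → ℝ) (p : ℝ) (u : Z d → ℝ) : ℝ :=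
  HnormP W h p u ^ (1 / p)

/-- Membership `u ∈ H_{s,p}`, i.e. `‖u‖_{H_{s,p}} < ∞` (all the defining series converge). -/
def memH (W : Z d → Z d → ℝ) (h : Z d → ℝ) (p : ℝ) (u : Z d → ℝ) : Prop :=
  (∀ x : Z d, Summable fun y : Z d => W x y * (u x - u y) ^ 2) ∧
  Summable fun x : Z d => gradNorm W u x ^ p + h x * |u x| ^ p

/-- The `ℓ^q` norm on `ℤ^d`. -/
def lnorm (q : ℝ) (u : Z d → ℝ) : ℝ := (∑' x : Z d, |u x| ^ q) ^ (1 / q)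

/-- The torus box `[0, 2π]^d`. -/
def box (d : ℕ) : Set (Fin d → ℝ) := Set.univ.pi fun _ => Set.Icc 0 (2 * Real.pi)

/-- `μ(k) = 2d − 2 ∑_j cos k_j`. -/
def muk (d : ℕ) (k : Fin d → ℝ) : ℝ := 2 * d - 2 * ∑ j, Real.cos (k j)

/-- The fractional degree `K_α = (2π)^{-d} ∫_{[0,2π]^d} μ(k)^{α/2} dk`. -/
def Kfrac (d : ℕ) (α : ℝ) : ℝ :=
  (2 * Real.pi) ^ (-(d : ℝ)) * ∫ k in box d, muk d k ^ (α / 2)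

/-- The Green's function `R_α(x,y)` of the discrete fractional Laplacian. -/
def Riesz (d : ℕ) (α : ℝ) (x y : Z d) : ℝ :=
  Kfrac d α * (2 * Real.pi) ^ (-(d : ℝ)) *
    ∫ k in box d, Real.cos (∑ j, ((x j - y j : ℤ) : ℝ) * k j) * muk d k ^ (-(α / 2))

/-- The convolution `(R_α ∗ v)(x) = ∑_y R_α(x,y) v(y)`. -/
def conv (d : ℕ) (α : ℝ) (v : Z d → ℝ) (x : Z d) : ℝ := ∑' y : Z d, Riesz d α x y * v y

/-- `F(t) = ∫_0^t f(r) dr`. -/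
def Fint (f : ℝ → ℝ) (t : ℝ) : ℝ := ∫ r in (0 : ℝ)..t, f r

/-- Positive part `u⁺ = max(u,0)`. -/
def pos (u : Z d → ℝ) (x : Z d) : ℝ := max (u x) 0

/-- Negative part `u⁻ = min(u,0)`. -/
def negp (u : Z d → ℝ) (x : Z d) : ℝ := min (u x) 0

/-- Hypothesis (h2): `h(x) → ∞` as `|x| → ∞`. -/
def H2 (h : Z d → ℝ) : Prop := Tendsto h cofinite atTop

/-- Hypothesis (f1): `f(t) = o(t^{p−1})` as `t → 0⁺`. -/
def F1 (f : ℝ → ℝ) (p : ℝ) : Prop :=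
  ∀ ε > (0 : ℝ), ∃ δ > (0 : ℝ), ∀ t : ℝ, 0 < t → t < δ → |f t| ≤ ε * t ^ (p - 1)

/-- Hypothesis (f3): `0 ≤ θ F(t) ≤ 2 f(t) t` for `t > 0`. -/
def F3 (f : ℝ → ℝ) (θ : ℝ) : Prop :=
  ∀ t > (0 : ℝ), 0 ≤ θ * Fint f t ∧ θ * Fint f t ≤ 2 * f t * t

/-- The energy functional `J̃`. -/
def energy (W : Z d → Z d → ℝ) (h : Z d → ℝ) (p α : ℝ) (f : ℝ → ℝ) (u : Z d → ℝ) : ℝ :=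
  (1 / p) * HnormP W h p u -
    (1 / 2) * ∑' x : Z d, conv d α (fun y => Fint f (pos u y)) x * Fint f (pos u x)

/-- The Nehari set `M`. -/
def Nehari (W : Z d → Z d → ℝ) (h : Z d → ℝ) (p α : ℝ) (f : ℝ → ℝ) : Set (Z d → ℝ) :=
  {u | memH W h p u ∧ u ≠ 0 ∧
    HnormP W h p u =
      ∑' x : Z d, conv d α (fun y => Fint f (pos u y)) x * f (pos u x) * pos u x}

/-- Hypothesis (f4). -/
def F4 (W : Z d → Z d → ℝ) (h : Z d → ℝ) (p α : ℝ) (f : ℝ → ℝ) : Prop :=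
  ∀ u : Z d → ℝ, memH W h p u → pos u ≠ 0 →
    StrictMonoOn (fun t : ℝ =>
      t ^ (1 - p) *
        ∑' x : Z d, conv d α (fun y => Fint f (t * pos u y)) x * f (t * pos u x) * pos u x)
      (Set.Ioi 0)

/-- The derivative pairing `⟨J̃′(u), φ⟩`. -/
def pairing (W : Z d → Z d → ℝ) (h : Z d → ℝ) (p α : ℝ) (f : ℝ → ℝ) (u φ : Z d → ℝ) : ℝ :=
  (∑' x : Z d,
      (gradNorm W u x ^ (p - 2) * gradForm W u φ x + h x * |u x| ^ (p - 2) * u x * φ x)) -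
    ∑' x : Z d, conv d α (fun y => Fint f (pos u y)) x * f (pos u x) * φ x


lemma box_restrict (d : ℕ) : (volume : Measure (Fin d → ℝ)).restrict (box d) =
    Measure.pi (fun _ : Fin d => (volume : Measure ℝ).restrict (Set.Icc 0 (2 * Real.pi))) := by
  unfold box
  rw [volume_pi, Measure.restrict_pi_pi]

lemma box_compact (d : ℕ) : IsCompact (box d) := isCompact_univ_pi fun _ => isCompact_Icc

lemma box_meas (d : ℕ) : MeasurableSet (box d) := (box_compact d).measurableSet

lemma muk_eq (d : ℕ) (k : Fin d → ℝ) : muk d k = 2 * ∑ j, (1 - Real.cos (k j)) := by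
  simp [muk, mul_sub]

lemma muk_nonneg (d : ℕ) (k : Fin d → ℝ) : 0 ≤ muk d k := by
  rw [muk_eq]
  exact mul_nonneg zero_le_two (Finset.sum_nonneg fun j _ => by linarith [Real.cos_le_one (k j)])

lemma muk_cont (d : ℕ) : Continuous (muk d) := by
  unfold muk; fun_prop

lemma muk_ge (d : ℕ) (k : Fin d → ℝ) (j : Fin d) : 1 - Real.cos (k j) ≤ muk d k := by
  rw [muk_eq]
  have h1 : 1 - Real.cos (k j) ≤ ∑ j, (1 - Real.cos (k j)) :=
    Finset.single_le_sum (f := fun j => 1 - Real.cos (k j))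
      (fun j _ => by linarith [Real.cos_le_one (k j)]) (Finset.mem_univ j)
  have h2 : 0 ≤ 1 - Real.cos (k j) := by linarith [Real.cos_le_one (k j)]
  linarith

lemma one_sub_cos_integrable {b : ℝ} (hb0 : 0 < b) (hb : b < 1 / 2) :
    IntegrableOn (fun k : ℝ => (1 - Real.cos k) ^ (-b)) (Set.Icc 0 (2 * Real.pi)) := by
  have hpi := Real.pi_pos
  rw [integrableOn_Icc_iff_integrableOn_Ioo]
  have i1 : IntegrableOn (fun k : ℝ => k ^ (-(2 * b))) (Set.Ioo 0 (2 * Real.pi)) := by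
    have := intervalIntegral.intervalIntegrable_rpow' (a := 0) (b := 2 * Real.pi)
      (r := -(2 * b)) (by linarith)
    rw [intervalIntegrable_iff_integrableOn_Ioo_of_le (by positivity)] at this
    exact this
  have i2 : IntegrableOn (fun k : ℝ => (2 * Real.pi - k) ^ (-(2 * b)))
      (Set.Ioo 0 (2 * Real.pi)) := by
    have := (intervalIntegral.intervalIntegrable_rpow' (a := 0) (b := 2 * Real.pi)
      (r := -(2 * b)) (by linarith)).comp_sub_left (2 * Real.pi)
    simp only [sub_zero, sub_self] at this
    have := this.symm
    rw [intervalIntegrable_iff_integrableOn_Ioo_of_le (by positivity)] at this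
    exact this
  set c : ℝ := 2 / Real.pi ^ 2 with hc
  have hcpos : 0 < c := by positivity
  refine Integrable.mono' ((i1.add i2).const_mul (c ^ (-b))) ?_ ?_
  · refine Measurable.aestronglyMeasurable ?_
    fun_prop
  · rw [ae_restrict_iff' measurableSet_Ioo]
    refine Eventually.of_forall fun k hk => ?_
    have hnn : 0 ≤ 1 - Real.cos k := by linarith [Real.cos_le_one k]
    rw [Real.norm_of_nonneg (Real.rpow_nonneg hnn _)]
    have key : ∀ z : ℝ, 0 < z → c * z ^ 2 ≤ 1 - Real.cos k →
        (1 - Real.cos k) ^ (-b) ≤ c ^ (-b) * z ^ (-(2 * b)) := by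
      intro z hz hle
      have : c ^ (-b) * z ^ (-(2 * b)) = (c * z ^ 2) ^ (-b) := by
        rw [Real.mul_rpow hcpos.le (by positivity), ← Real.rpow_natCast, ← Real.rpow_mul hz.le]
        congr 2
        push_cast
        ring
      rw [this]
      exact Real.rpow_le_rpow_of_nonpos (by positivity) hle (by linarith)
    simp only [Pi.add_apply]
    have p1 : 0 ≤ k ^ (-(2 * b)) := Real.rpow_nonneg hk.1.le _
    have p2 : 0 ≤ (2 * Real.pi - k) ^ (-(2 * b)) := Real.rpow_nonneg (by linarith [hk.2]) _
    have p3 : 0 ≤ c ^ (-b) := Real.rpow_nonneg hcpos.le _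
    rw [mul_add]
    rcases le_total k Real.pi with h | h
    · have := key k hk.1 (by
        have := Real.cos_le_one_sub_mul_cos_sq (x := k) (by rw [abs_of_pos hk.1]; exact h)
        linarith)
      have := mul_nonneg p3 p2
      linarith
    · have := key (2 * Real.pi - k) (by linarith [hk.2]) (by
        have := Real.cos_le_one_sub_mul_cos_sq (x := 2 * Real.pi - k)
          (by rw [abs_of_nonneg (by linarith [hk.2])]; linarith)
        rw [Real.cos_two_pi_sub] at this
        linarith)
      have := mul_nonneg p3 p1
      linarith

lemma ae_box_pos (d : ℕ) : ∀ᵐ k ∂((volume : Measure (Fin d → ℝ)).restrict (box d)),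
    ∀ j, 0 < 1 - Real.cos (k j) := by
  have h : Set.univ.pi (fun _ : Fin d => Set.Ioo (0:ℝ) (2 * Real.pi)) =ᵐ[volume] box d := by
    have := Measure.univ_pi_Ioo_ae_eq_Icc (μ := fun _ : Fin d => (volume : Measure ℝ))
      (f := fun _ => (0:ℝ)) (g := fun _ => 2 * Real.pi)
    rw [← Set.pi_univ_Icc] at this
    exact this
  rw [← Measure.restrict_congr_set h,
    ae_restrict_iff' (MeasurableSet.univ_pi fun _ => measurableSet_Ioo)]
  refine Eventually.of_forall fun k hk j => ?_
  have hkj := hk j (Set.mem_univ j)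
  have : Real.cos (k j) ≠ 1 := by
    intro h1
    have := (Real.cos_eq_one_iff_of_lt_of_lt (x := k j) (by linarith [hkj.1, Real.pi_pos]) hkj.2).1 h1
    linarith [hkj.1]
  have := lt_of_le_of_ne (Real.cos_le_one (k j)) this
  linarith

lemma muk_rpow_integrable {d : ℕ} (hd : 0 < d) {α : ℝ} (hα : α ∈ Set.Ioo (0 : ℝ) (d : ℝ)) :
    IntegrableOn (fun k => muk d k ^ (-(α / 2))) (box d) := by
  have hd' : (0:ℝ) < d := by exact_mod_cast hd
  set b : ℝ := α / (2 * d) with hb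
  have hb0 : 0 < b := div_pos hα.1 (by positivity)
  have hb1 : b < 1 / 2 := by
    rw [hb, div_lt_div_iff₀ (by positivity) (by norm_num)]
    linarith [hα.2]
  have hprod : Integrable (fun k : Fin d → ℝ => ∏ j, (1 - Real.cos (k j)) ^ (-b))
      ((volume : Measure (Fin d → ℝ)).restrict (box d)) := by
    rw [box_restrict]
    exact Integrable.fintype_prod (f := fun (_ : Fin d) (x : ℝ) => (1 - Real.cos x) ^ (-b))
      (fun _ => one_sub_cos_integrable hb0 hb1)
  refine Integrable.mono' hprod ?_ ?_
  · exact ((muk_cont d).measurable.pow_const _).aestronglyMeasurable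
  · filter_upwards [ae_box_pos d] with k hk
    rw [Real.norm_of_nonneg (Real.rpow_nonneg (muk_nonneg d k) _)]
    have : muk d k ^ (-(α / 2)) = ∏ _j : Fin d, muk d k ^ (-b) := by
      rw [Finset.prod_const, Finset.card_univ, Fintype.card_fin, ← Real.rpow_natCast,
        ← Real.rpow_mul (muk_nonneg d k)]
      congr 1
      rw [hb]; field_simp
    rw [this]
    refine Finset.prod_le_prod (fun j _ => Real.rpow_nonneg (muk_nonneg d k) _) fun j _ => ?_
    exact Real.rpow_le_rpow_of_nonpos (hk j) (muk_ge d k j) (by linarith)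

lemma cont_cos_sum {d : ℕ} (n : Fin d → ℤ) :
    Continuous fun k : Fin d → ℝ => Real.cos (∑ j, (n j : ℝ) * k j) := by fun_prop

lemma base_nonneg {d : ℕ} (n : Fin d → ℤ) :
    0 ≤ ∫ k in box d, Real.cos (∑ j, (n j : ℝ) * k j) := by
  have h1 : ∀ k : Fin d → ℝ, Real.cos (∑ j, (n j : ℝ) * k j) =
      (∏ j, Complex.exp (Complex.I * n j * k j)).re := by
    intro k
    rw [← Complex.exp_sum]
    have : ∑ j, Complex.I * (n j : ℂ) * (k j : ℂ) =
        ((∑ j, (n j : ℝ) * k j : ℝ) : ℂ) * Complex.I := by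
      push_cast
      rw [Finset.sum_mul]
      exact Finset.sum_congr rfl fun j _ => by ring
    rw [this, Complex.exp_ofReal_mul_I_re]
  simp_rw [h1]
  have hint : IntegrableOn
      (fun k : Fin d → ℝ => ∏ j, Complex.exp (Complex.I * n j * k j)) (box d) := by
    refine ContinuousOn.integrableOn_compact (box_compact d) (Continuous.continuousOn ?_)
    fun_prop
  have h2 := integral_re (𝕜 := ℂ) hint
  simp only [RCLike.re_eq_complex_re] at h2
  rw [h2, box_restrict, integral_fintype_prod_eq_prod
    (f := fun (j : Fin d) (x : ℝ) => Complex.exp (Complex.I * n j * x))]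
  have h3 : ∀ j, ∫ x in Set.Icc (0:ℝ) (2 * Real.pi), Complex.exp (Complex.I * n j * x) =
      ((if n j = 0 then 2 * Real.pi else 0 : ℝ) : ℂ) := by
    intro j
    rw [integral_Icc_eq_integral_Ioc, ← intervalIntegral.integral_of_le (by positivity)]
    split_ifs with h
    · simp [h]
    · have hc : Complex.I * (n j : ℂ) ≠ 0 :=
        mul_ne_zero Complex.I_ne_zero (by exact_mod_cast h)
      rw [integral_exp_mul_complex hc]
      have : Complex.I * (n j : ℂ) * ((2 * Real.pi : ℝ) : ℂ) = n j * (2 * Real.pi * Complex.I) := by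
        push_cast; ring
      rw [this, Complex.exp_int_mul_two_pi_mul_I]
      simp
  simp_rw [h3]
  rw [← Complex.ofReal_prod, Complex.ofReal_re]
  refine Finset.prod_nonneg fun j _ => ?_
  split_ifs <;> positivity

/-- functions with nonnegative cosine coefficients -/
def PosC (d : ℕ) (g : (Fin d → ℝ) → ℝ) : Prop :=
  ∀ n : Fin d → ℤ, 0 ≤ ∫ k in box d, Real.cos (∑ j, (n j : ℝ) * k j) * g k

lemma cint {d : ℕ} {g : (Fin d → ℝ) → ℝ} (hg : Continuous g) : IntegrableOn g (box d) :=
  hg.continuousOn.integrableOn_compact (box_compact d)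

lemma PosC.mul_cos {d : ℕ} {g : (Fin d → ℝ) → ℝ} (hgc : Continuous g) (hg : PosC d g)
    (i : Fin d) : PosC d (fun k => Real.cos (k i) * g k) := by
  intro n
  have e : ∀ k : Fin d → ℝ, Real.cos (∑ j, (n j : ℝ) * k j) * (Real.cos (k i) * g k) =
      (1 / 2) * (Real.cos (∑ j, (((n + Pi.single i 1 : Fin d → ℤ) j : ℤ) : ℝ) * k j) * g k) +
      (1 / 2) * (Real.cos (∑ j, (((n - Pi.single i 1 : Fin d → ℤ) j : ℤ) : ℝ) * k j) * g k) := by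
    intro k
    have a1 : ∑ j, (((n + Pi.single i 1 : Fin d → ℤ) j : ℤ) : ℝ) * k j = ∑ j, (n j : ℝ) * k j + k i := by
      simp [add_mul, Finset.sum_add_distrib, Pi.single_apply]
    have a2 : ∑ j, (((n - Pi.single i 1 : Fin d → ℤ) j : ℤ) : ℝ) * k j = ∑ j, (n j : ℝ) * k j - k i := by
      simp [sub_mul, Finset.sum_sub_distrib, Pi.single_apply]
    rw [a1, a2, Real.cos_add, Real.cos_sub]
    ring
  simp_rw [e]
  have c0 : ∀ m : Fin d → ℤ, Continuous fun k : Fin d → ℝ =>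
      Real.cos (∑ j, (m j : ℝ) * k j) * g k := by
    intro m; fun_prop
  rw [integral_add ((cint (c0 _)).const_mul _) ((cint (c0 _)).const_mul _), integral_const_mul, integral_const_mul]
  have := hg (n + Pi.single i 1)
  have := hg (n - Pi.single i 1)
  positivity

lemma PosC.mul_lin {d : ℕ} {g : (Fin d → ℝ) → ℝ} (hgc : Continuous g) (hg : PosC d g)
    {s : ℝ} (hs : 0 ≤ s) : PosC d (fun k => (1 + s * ∑ j, Real.cos (k j)) * g k) := by
  intro n
  have e : ∀ k : Fin d → ℝ, Real.cos (∑ j, (n j : ℝ) * k j) *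
        ((1 + s * ∑ j, Real.cos (k j)) * g k) =
      Real.cos (∑ j, (n j : ℝ) * k j) * g k +
      ∑ i, s * (Real.cos (∑ j, (n j : ℝ) * k j) * (Real.cos (k i) * g k)) := by
    intro k
    rw [← Finset.mul_sum, ← Finset.mul_sum, ← Finset.sum_mul]
    ring
  simp_rw [e]
  have ci : ∀ i : Fin d, Continuous fun k : Fin d → ℝ =>
      s * (Real.cos (∑ j, (n j : ℝ) * k j) * (Real.cos (k i) * g k)) := by
    intro i; fun_prop
  have c0 : Continuous fun k : Fin d → ℝ => Real.cos (∑ j, (n j : ℝ) * k j) * g k := by fun_prop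
  rw [integral_add (cint c0)
    (cint (continuous_finsetSum _ fun i _ => ci i)), integral_finsetSum _ fun i _ => cint (ci i)]
  refine add_nonneg (hg n) (Finset.sum_nonneg fun i _ => ?_)
  rw [integral_const_mul]
  exact mul_nonneg hs (PosC.mul_cos hgc hg i n)

lemma PosC.lin_pow {d : ℕ} {s : ℝ} (hs : 0 ≤ s) (m : ℕ) :
    PosC d (fun k => (1 + s * ∑ j, Real.cos (k j)) ^ m) := by
  induction m with
  | zero => intro n; simpa using base_nonneg n
  | succ m ih =>
    simp_rw [pow_succ']
    exact PosC.mul_lin (by fun_prop) ih hs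

lemma PosC.exp {d : ℕ} {s : ℝ} (hs : 0 ≤ s) :
    PosC d (fun k => Real.exp (s * ∑ j, Real.cos (k j))) := by
  intro n
  have hle : ∀ k : Fin d → ℝ, |s * ∑ j, Real.cos (k j)| ≤ s * d := by
    intro k
    rw [abs_mul, abs_of_nonneg hs]
    refine mul_le_mul_of_nonneg_left ?_ hs
    calc |∑ j, Real.cos (k j)| ≤ ∑ j, |Real.cos (k j)| := Finset.abs_sum_le_sum_abs _ _
      _ ≤ ∑ _j : Fin d, (1:ℝ) := Finset.sum_le_sum fun j _ => Real.abs_cos_le_one _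
      _ = d := by simp
  have ht : Tendsto (fun m : ℕ => ∫ k in box d, Real.cos (∑ j, (n j : ℝ) * k j) *
      (1 + (s / m) * ∑ j, Real.cos (k j)) ^ m) atTop
      (𝓝 (∫ k in box d, Real.cos (∑ j, (n j : ℝ) * k j) *
        Real.exp (s * ∑ j, Real.cos (k j)))) := by
    refine tendsto_integral_of_dominated_convergence (fun _ => Real.exp (s * d)) ?_ ?_ ?_ ?_
    · intro m
      exact Continuous.aestronglyMeasurable (by fun_prop)
    · exact cint continuous_const
    · intro m
      refine Eventually.of_forall fun k => ?_
      rw [norm_mul, norm_pow, Real.norm_eq_abs, Real.norm_eq_abs]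
      have h1 : |1 + s / m * ∑ j, Real.cos (k j)| ≤ 1 + (s * d) / m := by
        refine (abs_add_le _ _).trans ?_
        rw [abs_one]
        have : s / m * ∑ j, Real.cos (k j) = (s * ∑ j, Real.cos (k j)) / m := by ring
        rw [this, abs_div, Nat.abs_cast]
        gcongr
        exact hle k
      calc _ ≤ 1 * (1 + (s * d) / m) ^ m := by
            gcongr
            exact Real.abs_cos_le_one _
        _ ≤ Real.exp (s * d) := by
            rw [one_mul]
            rcases Nat.eq_zero_or_pos m with rfl | hm
            · simpa using by positivity
            · have : 1 + s * d / m ≤ Real.exp (s * d / m) := by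
                linarith [Real.add_one_le_exp (s * d / m)]
              calc _ ≤ (Real.exp (s * d / m)) ^ m := by gcongr
                _ = _ := by
                  rw [← Real.exp_nat_mul]
                  congr 1
                  field_simp
    · refine Eventually.of_forall fun k => ?_
      refine Tendsto.const_mul _ ?_
      refine (Real.tendsto_one_add_div_pow_exp (s * ∑ j, Real.cos (k j))).congr fun m => ?_
      congr 2
      ring
  exact ge_of_tendsto' ht fun m => PosC.lin_pow (by positivity) m n

lemma PosC.muk_rpow {d : ℕ} (hd : 0 < d) {α : ℝ} (hα : α ∈ Set.Ioo (0 : ℝ) (d : ℝ)) :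
    PosC d (fun k => muk d k ^ (-(α / 2))) := by
  intro n
  have ha : 0 < α / 2 := by linarith [hα.1]
  have hΓ := Real.Gamma_pos_of_pos ha
  set ν := (volume : Measure (Fin d → ℝ)).restrict (box d) with hν
  set H : (Fin d → ℝ) → ℝ → ℝ := fun k t =>
    Real.cos (∑ j, (n j : ℝ) * k j) * (t ^ (α / 2 - 1) * Real.exp (-(muk d k * t))) with hH
  have hpos : ∀ᵐ k ∂ν, 0 < muk d k := by
    filter_upwards [ae_box_pos d] with k hk
    exact lt_of_lt_of_le (hk ⟨0, hd⟩) (muk_ge d k _)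
  have hI : ∀ k, 0 < muk d k → ∫ t in Set.Ioi (0:ℝ), t ^ (α / 2 - 1) * Real.exp (-(muk d k * t))
      = muk d k ^ (-(α / 2)) * Real.Gamma (α / 2) := by
    intro k hk
    rw [Real.integral_rpow_mul_exp_neg_mul_Ioi ha hk, one_div, Real.inv_rpow hk.le,
      ← Real.rpow_neg hk.le]
  have hII : ∀ k, 0 < muk d k → IntegrableOn
      (fun t : ℝ => t ^ (α / 2 - 1) * Real.exp (-(muk d k * t))) (Set.Ioi 0) := by
    intro k hk
    refine MeasureTheory.Integrable.of_integral_ne_zero ?_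
    rw [hI k hk]
    have := Real.rpow_pos_of_pos hk (-(α / 2))
    positivity
  have hmeas : Measurable (Function.uncurry H) := by
    have := (muk_cont d).measurable
    have := (cont_cos_sum n).measurable
    simp only [hH, Function.uncurry_def]
    fun_prop
  have hint : Integrable (Function.uncurry H) (ν.prod (volume.restrict (Set.Ioi (0:ℝ)))) := by
    rw [integrable_prod_iff hmeas.aestronglyMeasurable]
    refine ⟨?_, ?_⟩
    · filter_upwards [hpos] with k hk
      exact (hII k hk).const_mul (Real.cos (∑ j, (n j : ℝ) * k j))
    · refine Integrable.mono' ((muk_rpow_integrable hd hα).mul_const (Real.Gamma (α / 2))) ?_ ?_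
      · exact (hmeas.norm.stronglyMeasurable.integral_prod_right').aestronglyMeasurable
      · filter_upwards [hpos] with k hk
        rw [Real.norm_of_nonneg (integral_nonneg fun _ => norm_nonneg _), ← hI k hk]
        refine integral_mono_ae ((hII k hk).const_mul (Real.cos (∑ j, (n j : ℝ) * k j))).norm (hII k hk) ?_
        rw [EventuallyLE, ae_restrict_iff' measurableSet_Ioi]
        refine Eventually.of_forall fun t ht => ?_
        simp only [hH, Function.uncurry]
        have : 0 ≤ t ^ (α / 2 - 1) := Real.rpow_nonneg (le_of_lt ht) _
        rw [norm_mul, Real.norm_of_nonneg (r := _ * _) (by positivity)]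
        exact mul_le_of_le_one_left (by positivity) (Real.abs_cos_le_one _)
  have hswap := integral_integral_swap hint
  have hl : ∫ k, (∫ t in Set.Ioi (0:ℝ), H k t) ∂ν =
      (∫ k, Real.cos (∑ j, (n j : ℝ) * k j) * muk d k ^ (-(α / 2)) ∂ν) *
        Real.Gamma (α / 2) := by
    rw [← integral_mul_const]
    refine integral_congr_ae ?_
    filter_upwards [hpos] with k hk
    simp only [hH]
    rw [integral_const_mul, hI k hk]
    ring
  have hr : 0 ≤ ∫ t in Set.Ioi (0:ℝ), ∫ k, H k t ∂ν := by
    refine setIntegral_nonneg measurableSet_Ioi fun t ht => ?_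
    have ht' : (0:ℝ) < t := ht
    have e : ∀ k, H k t = (t ^ (α / 2 - 1) * Real.exp (-(2 * d * t))) *
        (Real.cos (∑ j, (n j : ℝ) * k j) * Real.exp (2 * t * ∑ j, Real.cos (k j))) := by
      intro k
      simp only [hH]
      have : Real.exp (-(muk d k * t)) = Real.exp (-(2 * d * t)) *
          Real.exp (2 * t * ∑ j, Real.cos (k j)) := by
        rw [← Real.exp_add]; congr 1; unfold muk; ring
      rw [this]; ring
    simp_rw [e]
    rw [integral_const_mul]
    exact mul_nonneg (by positivity) (PosC.exp (by positivity) n)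
  rw [← hswap, hl] at hr
  exact nonneg_of_mul_nonneg_left hr hΓ

lemma Kfrac_nonneg (d : ℕ) (α : ℝ) : 0 ≤ Kfrac d α := by
  unfold Kfrac
  exact mul_nonneg (by positivity) (integral_nonneg fun k => Real.rpow_nonneg (muk_nonneg d k) _)

lemma Riesz_nonneg {d : ℕ} (hd : 0 < d) {α : ℝ} (hα : α ∈ Set.Ioo (0 : ℝ) (d : ℝ))
    (x y : Z d) : 0 ≤ Riesz d α x y :=
  mul_nonneg (mul_nonneg (Kfrac_nonneg d α) (by positivity))
    (PosC.muk_rpow hd hα (fun j => x j - y j))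

lemma Riesz_symm (d : ℕ) (α : ℝ) (x y : Z d) : Riesz d α x y = Riesz d α y x := by
  unfold Riesz
  congr 1
  refine integral_congr_ae (Eventually.of_forall fun k => ?_)
  simp only
  rw [← Real.cos_neg, ← Finset.sum_neg_distrib]
  congr 3
  ext j
  push_cast
  ring

lemma Riesz_bdd {d : ℕ} (hd : 0 < d) {α : ℝ} (hα : α ∈ Set.Ioo (0 : ℝ) (d : ℝ)) :
    ∃ B : ℝ, 0 ≤ B ∧ ∀ x y : Z d, Riesz d α x y ≤ B := by
  refine ⟨Kfrac d α * (2 * Real.pi) ^ (-(d : ℝ)) * ∫ k in box d, muk d k ^ (-(α / 2)),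
    mul_nonneg (mul_nonneg (Kfrac_nonneg d α) (by positivity))
      (integral_nonneg fun k => Real.rpow_nonneg (muk_nonneg d k) _), fun x y => ?_⟩
  unfold Riesz
  refine mul_le_mul_of_nonneg_left ?_ (mul_nonneg (Kfrac_nonneg d α) (by positivity))
  refine (le_abs_self _).trans ?_
  rw [← Real.norm_eq_abs]
  refine norm_integral_le_of_norm_le (muk_rpow_integrable hd hα) (Eventually.of_forall fun k => ?_)
  rw [norm_mul, Real.norm_of_nonneg (Real.rpow_nonneg (muk_nonneg d k) _)]
  exact mul_le_of_le_one_left (Real.rpow_nonneg (muk_nonneg d k) _) (Real.abs_cos_le_one _)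

lemma calculus_core {N p θ K : ℝ} (hN : 0 < N) (hp : 2 ≤ p) (hθ : p < θ) {Φ Ψ : ℝ → ℝ}
    (hder : ∀ t, 0 < t → HasDerivAt Ψ (2 * Φ t) t) (hcont : ContinuousOn Φ (Set.Ioi 0))
    (hΦ : ∀ t, 0 < t → 0 ≤ Φ t) (hΨ : ∀ t, 0 < t → 0 ≤ Ψ t)
    (hAR : ∀ t, 0 < t → θ * Ψ t ≤ 2 * (t * Φ t))
    (hmono : StrictMonoOn (fun t : ℝ => t ^ (1 - p) * Φ t) (Set.Ioi 0))
    (hsmall : ∀ t, 0 < t → t < 1 → Φ t ≤ K * t ^ (2 * p - 1)) :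
    ∃ tu, 0 < tu ∧ tu ^ (1 - p) * Φ tu = N ∧
      ∀ t, 0 < t → (1 / p) * (t ^ p * N) - (1 / 2) * Ψ t ≤
        (1 / p) * (tu ^ p * N) - (1 / 2) * Ψ tu := by
  have hp0 : 0 < p := by linarith
  have hΦpos : ∀ t, 0 < t → 0 < Φ t := by
    intro t ht
    have h1 := hmono (Set.mem_Ioi.2 (half_pos ht)) (Set.mem_Ioi.2 ht) (by linarith)
    simp only at h1
    have h2 : 0 ≤ (t / 2) ^ (1 - p) * Φ (t / 2) :=
      mul_nonneg (by positivity) (hΦ _ (half_pos ht))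
    have h3 : 0 < t ^ (1 - p) * Φ t := by linarith
    exact pos_of_mul_pos_right h3 (by positivity)
  have hΨ1 : 0 < Ψ 1 := by
    have hs : StrictMonoOn Ψ (Set.Icc (1 / 2) 1) := by
      refine strictMonoOn_of_deriv_pos (convex_Icc _ _) ?_ ?_
      · intro t ht
        exact (hder t (by linarith [ht.1])).continuousAt.continuousWithinAt
      · intro t ht
        rw [interior_Icc] at ht
        have ht0 : 0 < t := by linarith [ht.1]
        rw [(hder t ht0).deriv]
        linarith [hΦpos t ht0]
    have := hs (a := 1 / 2) (b := 1) (by norm_num) (by norm_num) (by norm_num)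
    linarith [hΨ (1 / 2) (by norm_num)]
  have hgrow : ∀ t, 1 ≤ t → Ψ 1 * t ^ θ ≤ Ψ t := by
    have hm : MonotoneOn (fun t : ℝ => Ψ t * t ^ (-θ)) (Set.Ici 1) := by
      have hd : ∀ t : ℝ, 0 < t → HasDerivAt (fun t : ℝ => Ψ t * t ^ (-θ))
          (2 * Φ t * t ^ (-θ) + Ψ t * (-θ * t ^ (-θ - 1))) t := fun t ht =>
        (hder t ht).mul (Real.hasDerivAt_rpow_const (Or.inl ht.ne'))
      refine monotoneOn_of_deriv_nonneg (convex_Ici _) ?_ ?_ ?_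
      · intro t ht
        exact (hd t (lt_of_lt_of_le one_pos ht)).continuousAt.continuousWithinAt
      · intro t ht
        rw [interior_Ici] at ht
        exact (hd t (lt_trans one_pos ht)).differentiableAt.differentiableWithinAt
      · intro t ht
        rw [interior_Ici] at ht
        have ht0 : 0 < t := lt_trans one_pos ht
        rw [(hd t ht0).deriv]
        have e : t ^ (-θ) = t ^ (-θ - 1) * t := by
          rw [Real.rpow_sub_one ht0.ne']; field_simp
        have : 2 * Φ t * t ^ (-θ) + Ψ t * (-θ * t ^ (-θ - 1)) =
            t ^ (-θ - 1) * (2 * (t * Φ t) - θ * Ψ t) := by rw [e]; ring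
        rw [this]
        exact mul_nonneg (by positivity) (by linarith [hAR t ht0])
    intro t ht
    have h1 := hm (Set.mem_Ici.2 le_rfl) (Set.mem_Ici.2 ht) ht
    have ht0 : 0 < t := by linarith
    simp only [Real.one_rpow, mul_one] at h1
    rw [Real.rpow_neg ht0.le, ← div_eq_mul_inv, le_div_iff₀ (by positivity)] at h1
    exact h1
  obtain ⟨t1, ht1, hbig⟩ : ∃ t1 : ℝ, 1 ≤ t1 ∧ N ≤ t1 ^ (1 - p) * Φ t1 := by
    have hc : 0 < θ / 2 * Ψ 1 := by have : 0 < θ := by linarith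
                                    positivity
    have htend := (tendsto_rpow_atTop (y := θ - p) (by linarith)).const_mul_atTop hc
    obtain ⟨t, h1, h2⟩ := ((htend.eventually_ge_atTop N).and (eventually_ge_atTop 1)).exists
    refine ⟨t, h2, h1.trans ?_⟩
    have ht0 : 0 < t := by linarith
    have h3 := hgrow t h2
    have h4 := hAR t ht0
    have h5 : θ / 2 * Ψ 1 * t ^ θ ≤ t * Φ t := by nlinarith
    have e1 : t ^ (θ - p) = t ^ θ * t ^ (-p) := by rw [← Real.rpow_add ht0]; rfl
    have e2 : t ^ (1 - p) = t * t ^ (-p) := by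
      rw [sub_eq_add_neg, Real.rpow_add ht0, Real.rpow_one]
    rw [e1, e2]
    have : 0 ≤ t ^ (-p) := by positivity
    nlinarith
  obtain ⟨t0, ht0, ht01, hlow⟩ : ∃ t0 : ℝ, 0 < t0 ∧ t0 < 1 ∧ t0 ^ (1 - p) * Φ t0 ≤ N := by
    have hc : Tendsto (fun t : ℝ => K * t ^ p) (𝓝[>] 0) (𝓝 0) := by
      have : ContinuousAt (fun t : ℝ => K * t ^ p) 0 :=
        continuousAt_const.mul (Real.continuousAt_rpow_const _ _ (Or.inr hp0.le))
      have h := this.tendsto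
      simp only [Real.zero_rpow hp0.ne', mul_zero] at h
      exact h.mono_left nhdsWithin_le_nhds
    obtain ⟨t, h1, h2⟩ := ((hc.eventually_le_const hN).and
      (Ioo_mem_nhdsGT (zero_lt_one (α := ℝ)))).exists
    refine ⟨t, h2.1, h2.2, le_trans ?_ h1⟩
    have h3 := hsmall t h2.1 h2.2
    have e : t ^ p = t ^ (1 - p) * t ^ (2 * p - 1) := by
      rw [← Real.rpow_add h2.1]; congr 1; ring
    rw [e]
    have : 0 ≤ t ^ (1 - p) := Real.rpow_nonneg h2.1.le _
    nlinarith
  have hgc : ContinuousOn (fun t : ℝ => t ^ (1 - p) * Φ t) (Set.Icc t0 t1) := by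
    refine ContinuousOn.mul ?_ (hcont.mono fun t ht => lt_of_lt_of_le ht0 ht.1)
    intro t ht
    exact (Real.continuousAt_rpow_const _ _
      (Or.inl (lt_of_lt_of_le ht0 ht.1).ne')).continuousWithinAt
  obtain ⟨tu, htu, htuN⟩ := intermediate_value_Icc (by linarith : t0 ≤ t1) hgc ⟨hlow, hbig⟩
  have htu0 : 0 < tu := lt_of_lt_of_le ht0 htu.1
  simp only at htuN
  refine ⟨tu, htu0, htuN, ?_⟩
  set J : ℝ → ℝ := fun t => (1 / p) * (t ^ p * N) - (1 / 2) * Ψ t with hJ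
  have hJd : ∀ t, 0 < t → HasDerivAt J (t ^ (p - 1) * (N - t ^ (1 - p) * Φ t)) t := by
    intro t ht
    have h1 := (((Real.hasDerivAt_rpow_const (x := t) (p := p) (Or.inl ht.ne')).mul_const
      N).const_mul (1 / p)).sub ((hder t ht).const_mul (1 / 2))
    refine HasDerivAt.congr_deriv h1 ?_
    have : t ^ (p - 1) * t ^ (1 - p) = 1 := by
      rw [← Real.rpow_add ht]; simp
    have h2 : t ^ (p - 1) * (N - t ^ (1 - p) * Φ t) =
        t ^ (p - 1) * N - (t ^ (p - 1) * t ^ (1 - p)) * Φ t := by ring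
    rw [h2, this]
    field_simp
  intro t ht
  change J t ≤ J tu
  rcases le_total t tu with hle | hle
  · have hm : MonotoneOn J (Set.Icc t tu) := by
      refine monotoneOn_of_deriv_nonneg (convex_Icc _ _) ?_ ?_ ?_
      · intro r hr
        exact (hJd r (lt_of_lt_of_le ht hr.1)).continuousAt.continuousWithinAt
      · intro r hr
        rw [interior_Icc] at hr
        exact (hJd r (lt_trans ht hr.1)).differentiableAt.differentiableWithinAt
      · intro r hr
        rw [interior_Icc] at hr
        have hr0 := lt_trans ht hr.1
        rw [(hJd r hr0).deriv]
        have := hmono (Set.mem_Ioi.2 hr0) (Set.mem_Ioi.2 htu0) hr.2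
        simp only at this
        exact mul_nonneg (by positivity) (by linarith)
    exact hm ⟨le_rfl, hle⟩ ⟨hle, le_rfl⟩ hle
  · have hm : AntitoneOn J (Set.Icc tu t) := by
      refine antitoneOn_of_deriv_nonpos (convex_Icc _ _) ?_ ?_ ?_
      · intro r hr
        exact (hJd r (lt_of_lt_of_le htu0 hr.1)).continuousAt.continuousWithinAt
      · intro r hr
        rw [interior_Icc] at hr
        exact (hJd r (lt_trans htu0 hr.1)).differentiableAt.differentiableWithinAt
      · intro r hr
        rw [interior_Icc] at hr
        have hr0 := lt_trans htu0 hr.1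
        rw [(hJd r hr0).deriv]
        have := hmono (Set.mem_Ioi.2 htu0) (Set.mem_Ioi.2 hr0) hr.1
        simp only at this
        exact mul_nonpos_of_nonneg_of_nonpos (by positivity) (by linarith)
    exact hm ⟨le_rfl, hle⟩ ⟨hle, le_rfl⟩ hle

lemma F_hasDeriv {f : ℝ → ℝ} (hfc : Continuous f) (t : ℝ) : HasDerivAt (Fint f) (f t) t :=
  intervalIntegral.integral_hasDerivAt_right (hfc.intervalIntegrable _ _)
    (hfc.stronglyMeasurableAtFilter _ _) hfc.continuousAt

lemma f_bound {f : ℝ → ℝ} {p : ℝ} (hp : 2 ≤ p) (hfc : Continuous f)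
    (hfz : ∀ t ≤ (0 : ℝ), f t = 0) (hf1 : F1 f p) (T : ℝ) :
    ∃ C : ℝ, 0 ≤ C ∧ ∀ r, 0 ≤ r → r ≤ T → f r ≤ C * r ^ (p - 1) ∧ Fint f r ≤ C * r ^ p := by
  obtain ⟨δ, hδ, h1⟩ := hf1 1 one_pos
  obtain ⟨M, hM⟩ := (isCompact_Icc (a := (0:ℝ)) (b := T)).exists_bound_of_continuousOn
    hfc.continuousOn
  set C : ℝ := 1 + |M| / δ ^ (p - 1) with hC
  have hC0 : 0 ≤ C := by positivity
  have hfb : ∀ r, 0 ≤ r → r ≤ T → f r ≤ C * r ^ (p - 1) := by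
    intro r hr hrT
    rcases hr.eq_or_lt with rfl | hr0
    · rw [hfz 0 le_rfl]; positivity
    · rcases lt_or_ge r δ with h | h
      · refine (le_abs_self _).trans ((h1 r hr0 h).trans ?_)
        gcongr
        rw [hC]
        have : 0 ≤ |M| / δ ^ (p - 1) := by positivity
        linarith
      · have h2 : f r ≤ |M| := (le_abs_self _).trans ((hM r ⟨hr, hrT⟩).trans (le_abs_self _))
        have h3 : δ ^ (p - 1) ≤ r ^ (p - 1) := Real.rpow_le_rpow hδ.le h (by linarith)
        have h4 : |M| ≤ |M| / δ ^ (p - 1) * r ^ (p - 1) := by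
          rw [div_mul_eq_mul_div, le_div_iff₀ (by positivity)]
          gcongr
        have : 0 ≤ r ^ (p - 1) := by positivity
        rw [hC]
        linarith
  refine ⟨C, hC0, fun r hr hrT => ⟨hfb r hr hrT, ?_⟩⟩
  rcases hr.eq_or_lt with rfl | hr0
  · simp [Fint]; positivity
  · calc Fint f r ≤ ∫ _s in (0:ℝ)..r, C * r ^ (p - 1) := by
          refine intervalIntegral.integral_mono_on hr (hfc.intervalIntegrable _ _)
            intervalIntegrable_const fun s hs => ?_
          refine (hfb s hs.1 (hs.2.trans hrT)).trans ?_
          exact mul_le_mul_of_nonneg_left (Real.rpow_le_rpow hs.1 hs.2 (by linarith)) hC0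
      _ = C * r ^ p := by
          rw [intervalIntegral.integral_const, Real.rpow_sub_one hr0.ne']
          simp only [smul_eq_mul, sub_zero]
          field_simp

section dbl
variable {ι : Type*} {R : ι → ι → ℝ} {B : ℝ}

lemma dbl_summable (hR0 : ∀ x y, 0 ≤ R x y) (hRB : ∀ x y, R x y ≤ B) {v w : ι → ℝ}
    (hv0 : ∀ x, 0 ≤ v x) (hw0 : ∀ x, 0 ≤ w x) (hv : Summable v) (hw : Summable w) :
    Summable (fun q : ι × ι => R q.1 q.2 * v q.2 * w q.1) := by
  have h := (hw.mul_of_nonneg hv hw0 hv0).mul_left B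
  refine Summable.of_nonneg_of_le (fun q => ?_) (fun q => ?_) h
  · exact mul_nonneg (mul_nonneg (hR0 _ _) (hv0 _)) (hw0 _)
  · have := mul_nonneg (hw0 q.1) (hv0 q.2)
    have := mul_le_mul_of_nonneg_right (hRB q.1 q.2) this
    linarith

lemma dbl_eq (hR0 : ∀ x y, 0 ≤ R x y) (hRB : ∀ x y, R x y ≤ B) {v w : ι → ℝ}
    (hv0 : ∀ x, 0 ≤ v x) (hw0 : ∀ x, 0 ≤ w x) (hv : Summable v) (hw : Summable w) :
    ∑' x, (∑' y, R x y * v y) * w x = ∑' q : ι × ι, R q.1 q.2 * v q.2 * w q.1 := by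
  rw [(dbl_summable hR0 hRB hv0 hw0 hv hw).tsum_prod]
  exact tsum_congr fun x => tsum_mul_right.symm

lemma dbl_symm (hRs : ∀ x y, R x y = R y x) (v w : ι → ℝ) :
    ∑' q : ι × ι, R q.1 q.2 * v q.2 * w q.1 = ∑' q : ι × ι, R q.1 q.2 * w q.2 * v q.1 := by
  rw [← (Equiv.prodComm ι ι).tsum_eq]
  refine tsum_congr fun q => ?_
  simp only [Equiv.prodComm_apply, Prod.fst_swap, Prod.snd_swap]
  rw [hRs]; ring

end dbl

section pack
variable {ι : Type*} {R : ι → ι → ℝ} {B p θ : ℝ} {f : ℝ → ℝ} {a : ι → ℝ}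

set_option maxHeartbeats 800000 in
lemma pack (hR0 : ∀ x y, 0 ≤ R x y) (hRB : ∀ x y, R x y ≤ B) (hB : 0 ≤ B)
    (hRs : ∀ x y, R x y = R y x) (hp : 2 ≤ p) (hfc : Continuous f)
    (hfz : ∀ t ≤ (0 : ℝ), f t = 0) (hf1 : F1 f p) (hf0 : ∀ t, 0 ≤ f t)
    (hF0 : ∀ t, 0 ≤ t → 0 ≤ Fint f t) (ha0 : ∀ x, 0 ≤ a x) (ha : Summable fun x => a x ^ p)
    {A : ℝ} (haA : ∀ x, a x ≤ A) {T : ℝ} (hT : 0 < T) :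
    (∀ t ∈ Set.Ioo 0 T, HasDerivAt
      (fun t => ∑' x, (∑' y, R x y * Fint f (t * a y)) * Fint f (t * a x))
      (2 * ∑' x, (∑' y, R x y * Fint f (t * a y)) * f (t * a x) * a x) t) ∧
    ContinuousOn (fun t => ∑' x, (∑' y, R x y * Fint f (t * a y)) * f (t * a x) * a x)
      (Set.Ioo 0 T) ∧
    (∃ K : ℝ, ∀ t ∈ Set.Ioo 0 T,
      ∑' x, (∑' y, R x y * Fint f (t * a y)) * f (t * a x) * a x ≤ K * t ^ (2 * p - 1)) ∧
    (∀ t ∈ Set.Ioo 0 T, (∀ r > (0:ℝ), θ * Fint f r ≤ 2 * f r * r) →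
      θ * (∑' x, (∑' y, R x y * Fint f (t * a y)) * Fint f (t * a x)) ≤
        2 * (t * ∑' x, (∑' y, R x y * Fint f (t * a y)) * f (t * a x) * a x)) := by
  obtain ⟨C, hC0, hC⟩ := f_bound hp hfc hfz hf1 (T * A)
  have hta0 : ∀ t ∈ Set.Ioo 0 T, ∀ x, 0 ≤ t * a x := fun t ht x => mul_nonneg ht.1.le (ha0 x)
  have htaT : ∀ t ∈ Set.Ioo 0 T, ∀ x, t * a x ≤ T * A := fun t ht x =>
    mul_le_mul ht.2.le (haA x) (ha0 x) hT.le
  have bF : ∀ t ∈ Set.Ioo 0 T, ∀ x, Fint f (t * a x) ≤ C * t ^ p * a x ^ p := by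
    intro t ht x
    have := (hC _ (hta0 t ht x) (htaT t ht x)).2
    rwa [Real.mul_rpow ht.1.le (ha0 x), ← mul_assoc] at this
  have bf : ∀ t ∈ Set.Ioo 0 T, ∀ x, f (t * a x) * a x ≤ C * t ^ (p - 1) * a x ^ p := by
    intro t ht x
    have := (hC _ (hta0 t ht x) (htaT t ht x)).1
    rw [Real.mul_rpow ht.1.le (ha0 x), ← mul_assoc] at this
    refine (mul_le_mul_of_nonneg_right this (ha0 x)).trans (le_of_eq ?_)
    rcases (ha0 x).eq_or_lt with h | h
    · rw [← h, Real.zero_rpow (by linarith : p ≠ 0)]; ring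
    · rw [mul_assoc, Real.rpow_sub_one h.ne']; field_simp
  have nF : ∀ t ∈ Set.Ioo 0 T, ∀ x, 0 ≤ Fint f (t * a x) := fun t ht x => hF0 _ (hta0 t ht x)
  have nf : ∀ t, ∀ x, 0 ≤ f (t * a x) * a x := fun t x => mul_nonneg (hf0 _) (ha0 x)
  have sF : ∀ t ∈ Set.Ioo 0 T, Summable fun x => Fint f (t * a x) := fun t ht =>
    Summable.of_nonneg_of_le (nF t ht) (bF t ht) (ha.mul_left _)
  have sf : ∀ t ∈ Set.Ioo 0 T, Summable fun x => f (t * a x) * a x := fun t ht =>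
    Summable.of_nonneg_of_le (nf t) (bf t ht) (ha.mul_left _)
  have nap : ∀ x, 0 ≤ a x ^ p := fun x => Real.rpow_nonneg (ha0 x) _
  have sS : Summable fun q : ι × ι => a q.1 ^ p * a q.2 ^ p := ha.mul_of_nonneg ha nap nap
  have sums1 : ∀ t ∈ Set.Ioo 0 T,
      Summable fun q : ι × ι => R q.1 q.2 * Fint f (t * a q.2) * Fint f (t * a q.1) :=
    fun t ht => dbl_summable (v := fun x => Fint f (t * a x))
      (w := fun x => Fint f (t * a x)) hR0 hRB (nF t ht) (nF t ht) (sF t ht) (sF t ht)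
  have sums2 : ∀ t ∈ Set.Ioo 0 T,
      Summable fun q : ι × ι => R q.1 q.2 * Fint f (t * a q.2) * (f (t * a q.1) * a q.1) :=
    fun t ht => dbl_summable (v := fun x => Fint f (t * a x))
      (w := fun x => f (t * a x) * a x) hR0 hRB (nF t ht) (nf t) (sF t ht) (sf t ht)
  have sums3 : ∀ t ∈ Set.Ioo 0 T,
      Summable fun q : ι × ι => R q.1 q.2 * (f (t * a q.2) * a q.2) * Fint f (t * a q.1) :=
    fun t ht => dbl_summable (v := fun x => f (t * a x) * a x)
      (w := fun x => Fint f (t * a x)) hR0 hRB (nf t) (nF t ht) (sf t ht) (sF t ht)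
  have eΨ : ∀ t ∈ Set.Ioo 0 T,
      ∑' x, (∑' y, R x y * Fint f (t * a y)) * Fint f (t * a x) =
      ∑' q : ι × ι, R q.1 q.2 * Fint f (t * a q.2) * Fint f (t * a q.1) := fun t ht =>
    dbl_eq (v := fun x => Fint f (t * a x))
      (w := fun x => Fint f (t * a x)) hR0 hRB (nF t ht) (nF t ht) (sF t ht) (sF t ht)
  have eΦ : ∀ t ∈ Set.Ioo 0 T,
      ∑' x, (∑' y, R x y * Fint f (t * a y)) * f (t * a x) * a x =
      ∑' q : ι × ι, R q.1 q.2 * Fint f (t * a q.2) * (f (t * a q.1) * a q.1) := fun t ht => by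
    rw [← dbl_eq (v := fun x => Fint f (t * a x))
      (w := fun x => f (t * a x) * a x) hR0 hRB (nF t ht) (nf t) (sF t ht) (sf t ht)]
    exact tsum_congr fun x => mul_assoc _ _ _
  have bq : ∀ t ∈ Set.Ioo 0 T, ∀ x y,
      R x y * Fint f (t * a y) * (f (t * a x) * a x) ≤
        B * C * C * t ^ (2 * p - 1) * (a x ^ p * a y ^ p) := by
    intro t ht x y
    have h1 := mul_le_mul (hRB x y) (bF t ht y) (nF t ht y) hB
    have h2 := mul_le_mul h1 (bf t ht x) (nf t x) (by
      have := nap y; have := ht.1; positivity)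
    refine h2.trans (le_of_eq ?_)
    have : t ^ (2 * p - 1) = t ^ p * t ^ (p - 1) := by
      rw [← Real.rpow_add ht.1]; congr 1; ring
    rw [this]; ring
  have nq : ∀ t ∈ Set.Ioo 0 T, ∀ x y, 0 ≤ R x y * Fint f (t * a y) * (f (t * a x) * a x) :=
    fun t ht x y => mul_nonneg (mul_nonneg (hR0 _ _) (nF t ht y)) (nf t x)
  have bqT : ∀ t ∈ Set.Ioo 0 T, ∀ x y,
      R x y * Fint f (t * a y) * (f (t * a x) * a x) ≤
        B * C * C * T ^ (2 * p - 1) * (a x ^ p * a y ^ p) := by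
    intro t ht x y
    refine (bq t ht x y).trans ?_
    have := nap x
    have := nap y
    have := Real.rpow_le_rpow ht.1.le ht.2.le (by linarith : 0 ≤ 2 * p - 1)
    gcongr
  have hFd : ∀ (x : ι) (t : ℝ), HasDerivAt (fun t => Fint f (t * a x)) (f (t * a x) * a x) t := by
    intro x t
    have h := (F_hasDeriv hfc (t * a x)).comp t ((hasDerivAt_id t).mul_const (a x))
    simp only [one_mul] at h
    exact h
  have hFc : ∀ x : ι, Continuous fun t => Fint f (t * a x) := fun x =>
    continuous_iff_continuousAt.2 fun t => (hFd x t).continuousAt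
  refine ⟨?_, ?_, ?_, ?_⟩
  · intro t ht
    have hd : HasDerivAt
        (fun t => ∑' q : ι × ι, R q.1 q.2 * Fint f (t * a q.2) * Fint f (t * a q.1))
        (∑' q : ι × ι, (R q.1 q.2 * (f (t * a q.2) * a q.2) * Fint f (t * a q.1) +
          R q.1 q.2 * Fint f (t * a q.2) * (f (t * a q.1) * a q.1))) t := by
      refine hasDerivAt_tsum_of_isPreconnected
        (g' := fun (q : ι × ι) t => R q.1 q.2 * (f (t * a q.2) * a q.2) * Fint f (t * a q.1) +
          R q.1 q.2 * Fint f (t * a q.2) * (f (t * a q.1) * a q.1))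
        (sS.mul_left (2 * (B * C * C * T ^ (2 * p - 1))))
        isOpen_Ioo isPreconnected_Ioo ?_ ?_ ht (sums1 t ht) ht
      · intro q r _
        exact ((hFd q.2 r).const_mul _).mul (hFd q.1 r)
      · intro q r hr
        have e : R q.1 q.2 * (f (r * a q.2) * a q.2) * Fint f (r * a q.1) =
            R q.2 q.1 * Fint f (r * a q.1) * (f (r * a q.2) * a q.2) := by
          rw [hRs q.1 q.2]; ring
        rw [e, Real.norm_of_nonneg (add_nonneg (nq r hr _ _) (nq r hr _ _))]
        have h1 := bqT r hr q.1 q.2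
        have h2 := bqT r hr q.2 q.1
        rw [mul_comm (a q.2 ^ p)] at h2
        linarith
    have hd2 := hd.congr_of_eventuallyEq
      (f₁ := fun t => ∑' x, (∑' y, R x y * Fint f (t * a y)) * Fint f (t * a x)) (by
        filter_upwards [isOpen_Ioo.mem_nhds ht] with r hr
        exact eΨ r hr)
    refine hd2.congr_deriv ?_
    rw [(sums3 t ht).tsum_add (sums2 t ht), eΦ t ht,
      dbl_symm hRs (fun x => f (t * a x) * a x) (fun x => Fint f (t * a x))]
    ring
  · refine ContinuousOn.congr ?_ eΦ
    refine continuousOn_tsum (u := fun q : ι × ι => B * C * C * T ^ (2 * p - 1) *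
      (a q.1 ^ p * a q.2 ^ p)) ?_ (sS.mul_left _) ?_
    · intro q
      have := hFc q.2
      exact Continuous.continuousOn (by fun_prop)
    · intro q r hr
      rw [Real.norm_of_nonneg (nq r hr _ _)]
      exact bqT r hr _ _
  · refine ⟨B * C * C * ∑' q : ι × ι, a q.1 ^ p * a q.2 ^ p, fun t ht => ?_⟩
    rw [eΦ t ht]
    have s4 : Summable fun q : ι × ι =>
        B * C * C * t ^ (2 * p - 1) * (a q.1 ^ p * a q.2 ^ p) := sS.mul_left _
    have hle : ∑' q : ι × ι, R q.1 q.2 * Fint f (t * a q.2) * (f (t * a q.1) * a q.1) ≤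
        ∑' q : ι × ι, B * C * C * t ^ (2 * p - 1) * (a q.1 ^ p * a q.2 ^ p) :=
      Summable.tsum_le_tsum (fun q : ι × ι => bq t ht q.1 q.2) (sums2 t ht) s4
    rw [tsum_mul_left] at hle
    refine hle.trans (le_of_eq ?_)
    ring
  · intro t ht hθ
    rw [eΨ t ht, eΦ t ht, ← mul_assoc, ← tsum_mul_left, ← tsum_mul_left]
    refine ((sums1 t ht).mul_left _).tsum_le_tsum (fun q => ?_) ((sums2 t ht).mul_left _)
    have h1 : θ * Fint f (t * a q.1) ≤ 2 * f (t * a q.1) * (t * a q.1) := by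
      rcases (hta0 t ht q.1).eq_or_lt with h | h
      · rw [← h]; simp [Fint]
      · exact hθ _ h
    have h2 := mul_nonneg (hR0 q.1 q.2) (nF t ht q.2)
    have h3 := mul_le_mul_of_nonneg_left h1 h2
    linarith

end pack

lemma pos_smul {d : ℕ} {t : ℝ} (ht : 0 < t) (u : Z d → ℝ) (x : Z d) :
    pos (fun x => t * u x) x = t * pos u x := by
  unfold pos
  rw [mul_max_of_nonneg _ _ ht.le, mul_zero]

lemma gradNorm_smul {d : ℕ} (W : Z d → Z d → ℝ) {t : ℝ} (ht : 0 < t) (u : Z d → ℝ) (x : Z d) :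
    gradNorm W (fun x => t * u x) x = t * gradNorm W u x := by
  unfold gradNorm
  have : ∀ y, W x y * (t * u x - t * u y) ^ 2 = t ^ 2 * (W x y * (u x - u y) ^ 2) := by
    intro y; ring
  simp_rw [this]
  rw [tsum_mul_left, mul_left_comm, Real.sqrt_mul (by positivity), Real.sqrt_sq ht.le]

lemma gradNorm_nonneg {d : ℕ} (W : Z d → Z d → ℝ) (u : Z d → ℝ) (x : Z d) :
    0 ≤ gradNorm W u x := Real.sqrt_nonneg _

lemma term_smul {d : ℕ} (W : Z d → Z d → ℝ) (h : Z d → ℝ) (p : ℝ) {t : ℝ} (ht : 0 < t)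
    (u : Z d → ℝ) (x : Z d) :
    gradNorm W (fun x => t * u x) x ^ p + h x * |t * u x| ^ p =
      t ^ p * (gradNorm W u x ^ p + h x * |u x| ^ p) := by
  rw [gradNorm_smul W ht, Real.mul_rpow ht.le (gradNorm_nonneg W u x), abs_mul, abs_of_pos ht,
    Real.mul_rpow ht.le (abs_nonneg _)]
  ring

lemma HnormP_smul {d : ℕ} (W : Z d → Z d → ℝ) (h : Z d → ℝ) (p : ℝ) {t : ℝ} (ht : 0 < t)
    (u : Z d → ℝ) : HnormP W h p (fun x => t * u x) = t ^ p * HnormP W h p u := by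
  unfold HnormP
  rw [← tsum_mul_left]
  exact tsum_congr fun x => term_smul W h p ht u x

lemma memH_smul {d : ℕ} {W : Z d → Z d → ℝ} {h : Z d → ℝ} {p : ℝ} {t : ℝ} (ht : 0 < t)
    {u : Z d → ℝ} (hu : memH W h p u) : memH W h p (fun x => t * u x) := by
  refine ⟨fun x => ?_, ?_⟩
  · have : ∀ y, W x y * (t * u x - t * u y) ^ 2 = t ^ 2 * (W x y * (u x - u y) ^ 2) := by
      intro y; ring
    simp_rw [this]
    exact (hu.1 x).mul_left _
  · simp_rw [term_smul W h p ht u]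
    exact hu.2.mul_left _

lemma HnormP_pos {d : ℕ} {W : Z d → Z d → ℝ} {h : Z d → ℝ} {p h₀ : ℝ}
    (hh₀ : 0 < h₀) (hh1 : ∀ x, h₀ ≤ h x) {u : Z d → ℝ} (hu : memH W h p u) (hu0 : u ≠ 0) :
    0 < HnormP W h p u := by
  obtain ⟨x, hx⟩ := Function.ne_iff.1 hu0
  have hx' : 0 < |u x| := abs_pos.2 hx
  have hhp : ∀ x, 0 < h x := fun x => lt_of_lt_of_le hh₀ (hh1 x)
  refine hu.2.tsum_pos (fun y => ?_) x ?_
  · have := hhp y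
    have := gradNorm_nonneg W u y
    positivity
  · have := hhp x
    have := gradNorm_nonneg W u x
    positivity

lemma summable_pos {d : ℕ} {W : Z d → Z d → ℝ} {h : Z d → ℝ} {p h₀ : ℝ} (hp : 2 ≤ p)
    (hh₀ : 0 < h₀) (hh1 : ∀ x, h₀ ≤ h x) {u : Z d → ℝ} (hu : memH W h p u) :
    Summable fun x => pos u x ^ p := by
  refine Summable.of_nonneg_of_le (fun x => Real.rpow_nonneg (le_max_right _ _) _) (fun x => ?_)
    (hu.2.mul_left h₀⁻¹)
  have h1 : pos u x ^ p ≤ |u x| ^ p :=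
    Real.rpow_le_rpow (le_max_right _ _) (max_le (le_abs_self _) (abs_nonneg _)) (by linarith)
  have h2 : 0 ≤ gradNorm W u x ^ p := Real.rpow_nonneg (gradNorm_nonneg W u x) _
  have h3 : 0 ≤ |u x| ^ p := by positivity
  rw [inv_mul_eq_div, le_div_iff₀ hh₀]
  nlinarith [hh1 x]

lemma bdd_of_summable {ι : Type*} {a : ι → ℝ} {p : ℝ} (hp : 2 ≤ p) (ha0 : ∀ x, 0 ≤ a x)
    (ha : Summable fun x => a x ^ p) : ∃ A, ∀ x, a x ≤ A := by
  refine ⟨(∑' x, a x ^ p) ^ (1 / p), fun x => ?_⟩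
  have h1 : a x ^ p ≤ ∑' x, a x ^ p :=
    ha.le_tsum x fun y _ => Real.rpow_nonneg (ha0 y) _
  calc a x = (a x ^ p) ^ (1 / p) := by
        rw [← Real.rpow_mul (ha0 x), mul_one_div_cancel (by linarith), Real.rpow_one]
    _ ≤ _ := Real.rpow_le_rpow (Real.rpow_nonneg (ha0 x) _) h1 (by positivity)

theorem unique_nehari_projection
    {d : ℕ} (hd : 0 < d) {s p : ℝ} (hs : s ∈ Set.Ioo (0 : ℝ) 1) (hp : 2 ≤ p)
    {W : Z d → Z d → ℝ} (hW : KernelOK d s W)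
    {α : ℝ} (hα : α ∈ Set.Ioo (0 : ℝ) (d : ℝ))
    {h : Z d → ℝ} {h₀ : ℝ} (hh₀ : 0 < h₀) (hh1 : ∀ x, h₀ ≤ h x)
    {f : ℝ → ℝ} (hfc : Continuous f) (hfz : ∀ t ≤ (0 : ℝ), f t = 0)
    (hf1 : F1 f p)
    {C₀ τ : ℝ} (hC₀ : 0 < C₀) (hτ : ((d : ℝ) + α) * p / (2 * d) < τ)
    (hf2 : ∀ t > (0 : ℝ), f t ≤ C₀ * (1 + t ^ (τ - 1)))
    {θ : ℝ} (hθ : p < θ) (hf3 : F3 f θ)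
    (hf4 : F4 W h p α f)
 :
    (∀ u : Z d → ℝ, memH W h p u → pos u ≠ 0 →
      ∃ tu : ℝ, 0 < tu ∧ (fun x => tu * u x) ∈ Nehari W h p α f ∧
        (∀ t > (0 : ℝ), energy W h p α f (fun x => t * u x) ≤
          energy W h p α f (fun x => tu * u x)) ∧
        (∀ t' : ℝ, 0 < t' → (fun x => t' * u x) ∈ Nehari W h p α f → t' = tu)) ∧
    ∀ u ∈ Nehari W h p α f, ∀ t > (0 : ℝ),
      energy W h p α f (fun x => t * u x) ≤ energy W h p α f u := by
  have hp0 : 0 < p := by linarith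
  have hθ0 : 0 < θ := by linarith
  have hF0 : ∀ t, 0 ≤ t → 0 ≤ Fint f t := by
    intro t ht
    rcases ht.eq_or_lt with rfl | ht
    · simp [Fint]
    · exact nonneg_of_mul_nonneg_right (hf3 t ht).1 hθ0
  have hf0 : ∀ t, 0 ≤ f t := by
    intro t
    rcases le_or_gt t 0 with ht | ht
    · exact (hfz t ht).ge
    · have h1 := (hf3 t ht).1.trans (hf3 t ht).2
      have h2 := nonneg_of_mul_nonneg_left h1 ht
      linarith
  obtain ⟨B, hB, hRB⟩ := Riesz_bdd hd hα
  have main : ∀ u : Z d → ℝ, memH W h p u → pos u ≠ 0 →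
      ∃ tu : ℝ, 0 < tu ∧ (fun x => tu * u x) ∈ Nehari W h p α f ∧
        (∀ t > (0 : ℝ), energy W h p α f (fun x => t * u x) ≤
          energy W h p α f (fun x => tu * u x)) ∧
        (∀ t' : ℝ, 0 < t' → (fun x => t' * u x) ∈ Nehari W h p α f → t' = tu) := by
    intro u hu hpu
    have hu0 : u ≠ 0 := by
      rintro rfl
      exact hpu (by funext x; simp [pos])
    have hN := HnormP_pos hh₀ hh1 hu hu0
    have ha0 : ∀ x, 0 ≤ pos u x := fun x => le_max_right _ _
    have ha := summable_pos hp hh₀ hh1 hu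
    obtain ⟨A, hA⟩ := bdd_of_summable hp ha0 ha
    have P := fun {T : ℝ} (hT : 0 < T) => pack (θ := θ) (Riesz_nonneg hd hα) hRB hB
      (Riesz_symm d α) hp hfc hfz hf1 hf0 hF0 ha0 ha hA hT
    have hm := hf4 u hu hpu
    simp only [conv] at hm
    set Φ : ℝ → ℝ := fun t => ∑' x, (∑' y, Riesz d α x y * Fint f (t * pos u y)) *
      f (t * pos u x) * pos u x with hΦ
    set Ψ : ℝ → ℝ := fun t => ∑' x, (∑' y, Riesz d α x y * Fint f (t * pos u y)) *
      Fint f (t * pos u x) with hΨ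
    have hin : ∀ t : ℝ, 0 < t → t ∈ Set.Ioo 0 (t + 1) := fun t ht => ⟨ht, by linarith⟩
    have hcn : ∀ t : ℝ, 0 < t → ∀ x, 0 ≤ ∑' y, Riesz d α x y * Fint f (t * pos u y) :=
      fun t ht x => tsum_nonneg fun y =>
        mul_nonneg (Riesz_nonneg hd hα x y) (hF0 _ (mul_nonneg ht.le (ha0 y)))
    obtain ⟨K, hK⟩ := (P one_pos).2.2.1
    obtain ⟨tu, htu, htuN, hmax⟩ := calculus_core (N := HnormP W h p u) (K := K) (Φ := Φ) (Ψ := Ψ)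
      hN hp hθ
      (fun t ht => (P (by linarith : 0 < t + 1)).1 t (hin t ht))
      (fun t ht => ((P (by linarith [Set.mem_Ioi.1 ht] : 0 < t + 1)).2.1.continuousAt
        (isOpen_Ioo.mem_nhds (hin t ht))).continuousWithinAt)
      (fun t ht => tsum_nonneg fun x => mul_nonneg (mul_nonneg (hcn t ht x) (hf0 _)) (ha0 x))
      (fun t ht => tsum_nonneg fun x => mul_nonneg (hcn t ht x)
        (hF0 _ (mul_nonneg ht.le (ha0 x))))
      (fun t ht => (P (by linarith : 0 < t + 1)).2.2.2 t (hin t ht) fun r hr => (hf3 r hr).2)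
      hm
      (fun t ht ht1 => hK t ⟨ht, ht1⟩)
    have hen : ∀ t : ℝ, 0 < t → energy W h p α f (fun x => t * u x) =
        (1 / p) * (t ^ p * HnormP W h p u) - (1 / 2) * Ψ t := by
      intro t ht
      simp only [energy, conv, HnormP_smul W h p ht, pos_smul ht, hΨ]
    have hne : ∀ t : ℝ, 0 < t → ((fun x => t * u x) ∈ Nehari W h p α f ↔
        t ^ (1 - p) * Φ t = HnormP W h p u) := by
      intro t ht
      have e1 : ∑' x : Z d, conv d α (fun y => Fint f (pos (fun x => t * u x) y)) x *
          f (pos (fun x => t * u x) x) * pos (fun x => t * u x) x = t * Φ t := by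
        simp only [conv, pos_smul ht, hΦ]
        rw [← tsum_mul_left]
        exact tsum_congr fun x => by ring
      have e2 : t ^ (1 - p) * t ^ p = t := by
        rw [← Real.rpow_add ht]; simp
      have hpp : 0 < t ^ (1 - p) := Real.rpow_pos_of_pos ht _
      constructor
      · rintro ⟨-, -, h3⟩
        rw [HnormP_smul W h p ht, e1] at h3
        have h4 : t * HnormP W h p u = t * (t ^ (1 - p) * Φ t) := by
          calc t * HnormP W h p u = t ^ (1 - p) * (t ^ p * HnormP W h p u) := by
                rw [← mul_assoc, e2]
            _ = _ := by rw [h3]; ring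
        exact (mul_left_cancel₀ ht.ne' h4).symm
      · intro h3
        refine ⟨memH_smul ht hu, ?_, ?_⟩
        · intro h0
          refine hu0 (funext fun x => ?_)
          have := congrFun h0 x
          simpa [ht.ne'] using this
        · rw [HnormP_smul W h p ht, e1, ← h3]
          calc t ^ p * (t ^ (1 - p) * Φ t) = (t ^ (1 - p) * t ^ p) * Φ t := by ring
            _ = _ := by rw [e2]
    refine ⟨tu, htu, (hne tu htu).2 htuN, ?_, ?_⟩
    · intro t ht
      rw [hen t ht, hen tu htu]
      exact hmax t ht
    · intro t' ht' hmem
      exact hm.injOn ht' htu (((hne t' ht').1 hmem).trans htuN.symm)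
  refine ⟨main, ?_⟩
  intro u hu t ht
  have hpu : pos u ≠ 0 := by
    intro h0
    have h1 := HnormP_pos hh₀ hh1 hu.1 hu.2.1
    have h2 := hu.2.2
    simp [h0] at h2
    linarith
  obtain ⟨tu, _, _, hmax, huniq⟩ := main u hu.1 hpu
  have h1 : (1:ℝ) = tu := huniq 1 one_pos (by simpa using hu)
  subst h1
  simpa using hmax t ht

end DiscreteChoquard
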